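/- Let E be a metric space and ξ : E → ℝ a continuous function. Equip the space C([0,∞), E) of continuous paths with the compact-open topology (topology of locally uniform convergence), and equip [0,∞) × C([0,∞), E) with the Borel σ-algebra of the product topology. Then the set F := { (s, y) ∈ [0,∞) × C([0,∞), E) : ξ(y(0)) = 0 and ξ(y(s')) < ξ(y(s)) for every s' ∈ [0, s) } is a Borel subset of [0,∞) × C([0,∞), E). -/

import Mathlib

open Filter Topology MeasureTheory
open scoped NNReal

/-- The points of a continuous family of real functions at which the function is below a continuous
threshold on a given compact set form an open set. -/
theorem isOpen_setOf_forall_mem_lt_of_isCompact {T X : Type*} [TopologicalSpace T]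
    [TopologicalSpace X] {K : Set T} (hK : IsCompact K) {f : X → T → ℝ} {g : X → ℝ}
    (hf : Continuous fun p : X × T => f p.1 p.2) (hg : Continuous g) :
    IsOpen {x | ∀ t ∈ K, f x t < g x} := by
  rw [isOpen_iff_eventually]
  intro x hx
  exact hK.eventually_forall_of_forall_eventually fun t ht =>
    hf.continuousAt.eventually_lt (hg.comp continuous_fst).continuousAt (hx t ht)

/-- The set of continuous paths with a marked terminal time at which the level
function `ξ` attains, for the first time, a value strictly above all earlier
values (and with initial level `0`) is a Borel subset of
`[0,∞) × C([0,∞), E)` for the product topology (compact-open topology on the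
path space). -/
theorem measurableSet_levelIndexed_state_space {E : Type*} [MetricSpace E]
    (ξ : E → ℝ) (hξ : Continuous ξ) :
    MeasurableSet[borel (ℝ≥0 × C(ℝ≥0, E))]
      {p : ℝ≥0 × C(ℝ≥0, E) |
        ξ (p.2 0) = 0 ∧ ∀ s' < p.1, ξ (p.2 s') < ξ (p.2 p.1)} := by
  let _ : MeasurableSpace (ℝ≥0 × C(ℝ≥0, E)) := borel _
  have : BorelSpace (ℝ≥0 × C(ℝ≥0, E)) := ⟨rfl⟩
  have h_eq : {p : ℝ≥0 × C(ℝ≥0, E) |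
      ξ (p.2 0) = 0 ∧ ∀ s' < p.1, ξ (p.2 s') < ξ (p.2 p.1)} =
      {p | ξ (p.2 0) = 0} ∩ ⋂ n : ℕ, ({p | p.1 ≤ TopologicalSpace.denseSeq ℝ≥0 n} ∪
        {p | ∀ t ∈ Set.Icc 0 (TopologicalSpace.denseSeq ℝ≥0 n), ξ (p.2 t) < ξ (p.2 p.1)}) := by
    ext p
    simp only [Set.mem_inter_iff, Set.mem_iInter, Set.mem_union, Set.mem_ofPred_eq]
    refine and_congr_right fun _ => ⟨fun h n => ?_, fun h t ht => ?_⟩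
    · exact (le_or_gt _ _).imp_right fun hn t ht => h t (ht.2.trans_lt hn)
    · obtain ⟨_, ⟨n, rfl⟩, htn, hn⟩ :=
        (TopologicalSpace.denseRange_denseSeq ℝ≥0).exists_between ht
      exact (h n).resolve_left hn.not_ge t ⟨zero_le, htn.le⟩
  rw [h_eq]
  refine MeasurableSet.inter ?_ (MeasurableSet.iInter fun n => MeasurableSet.union ?_ ?_)
  · exact (isClosed_eq (f := fun p : ℝ≥0 × C(ℝ≥0, E) => ξ (p.2 0)) (by fun_prop) continuous_const).measurableSet
  · exact (isClosed_le continuous_fst continuous_const).measurableSet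
  · exact (isOpen_setOf_forall_mem_lt_of_isCompact isCompact_Icc
      (f := fun (p : ℝ≥0 × C(ℝ≥0, E)) t => ξ (p.2 t)) (by fun_prop) (by fun_prop)).measurableSet
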